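/- Let L be a finite semidistributive lattice and suppose some element of L is covered by exactly n elements (i.e., has n upper covers). Then the order dimension of L is at least n. -/

import Mathlib

universe u

/-- A lattice is semidistributive if `x ⊔ y = x ⊔ z → x ⊔ (y ⊓ z) = x ⊔ y` and
`x ⊓ y = x ⊓ z → x ⊓ (y ⊔ z) = x ⊓ y`. -/
def IsSemidistributive (β : Type u) [Lattice β] : Prop :=
  (∀ x y z : β, x ⊔ y = x ⊔ z → x ⊔ (y ⊓ z) = x ⊔ y) ∧
  (∀ x y z : β, x ⊓ y = x ⊓ z → x ⊓ (y ⊔ z) = x ⊓ y)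

/-- The order dimension of a finite poset: the smallest `n` such that the poset embeds
into `ℝ^n` with the componentwise order. -/
noncomputable def orderDim (P : Type u) [Preorder P] : ℕ :=
  sInf {n : ℕ | ∃ f : P → (Fin n → ℝ), ∀ a b : P, a ≤ b ↔ f a ≤ f b}

/-- In a meet-semidistributive lattice, a cover `y` of `x` meets some common upper bound of any
finite set of other covers of `x` exactly in `x`. -/
theorem IsSemidistributive.exists_upper_bound_inf_eq {β : Type u} [Lattice β]
    (hsd : IsSemidistributive β) {x y : β} (hy : x ⋖ y) (s : Finset β)
    (hs : ∀ w ∈ s, x ⋖ w ∧ w ≠ y) :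
    ∃ z, (∀ w ∈ s, w ≤ z) ∧ y ⊓ z = x := by
  classical
  induction s using Finset.induction_on with
  | empty => exact ⟨x, by simp, inf_eq_right.2 hy.le⟩
  | insert w s _ ih =>
    obtain ⟨z, hz, hyz⟩ := ih fun v hv => hs v (Finset.mem_insert_of_mem hv)
    obtain ⟨hw, hwy⟩ := hs w (Finset.mem_insert_self w s)
    have hyw : y ⊓ w = x := by
      by_contra hne
      have hlt : x < y ⊓ w := lt_of_le_of_ne (le_inf hy.le hw.le) (Ne.symm hne)
      have h₁ : y ⊓ w = y := (hy.eq_or_eq hlt.le inf_le_left).resolve_left hlt.ne'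
      have h₂ : y ⊓ w = w := (hw.eq_or_eq hlt.le inf_le_right).resolve_left hlt.ne'
      exact hwy (h₂.symm.trans h₁)
    refine ⟨z ⊔ w, fun v hv => ?_, (hsd.2 y z w (hyz.trans hyw.symm)).trans hyz⟩
    rcases Finset.mem_insert.1 hv with rfl | hv
    · exact le_sup_right
    · exact (hz v hv).trans le_sup_left

/-- A finite preorder embeds into some `ℝ^n`, so its order dimension is attained. -/
theorem exists_embedding_orderDim (P : Type u) [Preorder P] [Fintype P] :
    ∃ f : P → (Fin (orderDim P) → ℝ), ∀ a b : P, a ≤ b ↔ f a ≤ f b := by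
  classical
  refine Nat.sInf_mem (s := {n : ℕ | ∃ f : P → (Fin n → ℝ), ∀ a b : P, a ≤ b ↔ f a ≤ f b})
    ⟨Fintype.card P, fun a i => if (Fintype.equivFin P).symm i ≤ a then 1 else 0,
      fun a b => ⟨fun h i => ?_, fun h => ?_⟩⟩
  · by_cases hi : (Fintype.equivFin P).symm i ≤ a
    · simp [hi, hi.trans h]
    · simp only [hi, if_false]
      split_ifs <;> norm_num
  · by_contra hab
    have := h (Fintype.equivFin P a)
    norm_num [hab] at this

/-- If every `y i` fails to lie below `z i` but lies below all other `z j` (a standard example),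
then any embedding of the preorder into `ℝ^m` needs at least as many coordinates as indices. -/
theorem card_le_of_standard_example {P : Type u} [Preorder P] {ι : Type*} [Fintype ι] {m : ℕ}
    (f : P → (Fin m → ℝ)) (hf : ∀ a b : P, a ≤ b ↔ f a ≤ f b) (y z : ι → P)
    (hne : ∀ i, ¬ y i ≤ z i) (hle : ∀ i j, i ≠ j → y i ≤ z j) :
    Fintype.card ι ≤ m := by
  have hc : ∀ i, ∃ c, f (z i) c < f (y i) c := fun i => by
    simpa [hf, Pi.le_def] using hne i
  choose c hc using hc
  have hinj : Function.Injective c := fun i j hij => by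
    by_contra hne'
    have h₁ := (hf _ _).1 (hle i j hne') (c i)
    have h₂ := (hf _ _).1 (hle j i (Ne.symm hne')) (c i)
    have h₃ := hc i
    have h₄ := hc j
    rw [← hij] at h₄
    linarith
  simpa using Fintype.card_le_of_injective c hinj

/-- If some element of a finite semidistributive lattice is covered by exactly `n`
elements, then the order dimension of the lattice is at least `n`. -/
theorem dim_ge_of_upper_covers (α : Type u) [Lattice α] [Fintype α] [Nonempty α]
    (hsd : IsSemidistributive α) (x : α) (n : ℕ)
    (hx : {y : α | x ⋖ y}.ncard = n) :
    n ≤ orderDim α := by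
  classical
  obtain ⟨f, hf⟩ := exists_embedding_orderDim α
  have hz : ∀ y : {y : α | x ⋖ y}, ∃ z, (∀ w, x ⋖ w → w ≠ y → w ≤ z) ∧ (y : α) ⊓ z = x := by
    rintro ⟨y, hy⟩
    obtain ⟨z, hz, hyz⟩ := hsd.exists_upper_bound_inf_eq hy
      (Finset.univ.filter fun w => x ⋖ w ∧ w ≠ y) (by simp)
    exact ⟨z, fun w hw hwy => hz w (by simp [hw, hwy]), hyz⟩
  choose z hz hyz using hz
  have hcard := card_le_of_standard_example f hf (fun y : {y : α | x ⋖ y} => (y : α)) z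
    (fun y hle => y.2.lt.ne' ((inf_eq_left.2 hle).symm.trans (hyz y)))
    (fun y w hyw => hz w y y.2 fun h => hyw (Subtype.ext h))
  rwa [← hx, ← Nat.card_coe_set_eq, Nat.card_eq_fintype_card]
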